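/- The square of the (homogeneous) Q condition map is a generalized Q map: let N ≥ 2 be an integer. Then for every Γ : Matrix (ι × ι) (ι × ι) ℝ, Q(1, 1/(N(N−1)), 1/(N−1)) ( Q(1, 1/(N(N−1)), 1/(N−1)) (Γ) ) = Q(a, b, c)(Γ) with a = 1, b = (4N² + 2N − 4NM + M² − M) / (N²(N−1)²), and c = (2N − M) / (N−1)². -/

import Mathlib

open Matrix

/-- The partial trace of a matrix on pair indices:
`Γ̄_{αγ} = Σ_λ Γ_{(α,λ),(γ,λ)}`. -/
def pTr {ι : Type*} [Fintype ι] (Γ : Matrix (ι × ι) (ι × ι) ℝ) : Matrix ι ι ℝ :=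
  fun α γ => ∑ l : ι, Γ (α, l) (γ, l)

/-- The double trace `Γ̄̄ = Σ_α Γ̄_{αα}`. -/
def dTr {ι : Type*} [Fintype ι] (Γ : Matrix (ι × ι) (ι × ι) ℝ) : ℝ :=
  ∑ α : ι, pTr Γ α α

/-- The generalized `Q` map with coefficients `(a, b, c)`:
`Q(a,b,c)(Γ)_{(α,β),(γ,δ)} = a·Γ_{(α,β),(γ,δ)}
  + b·(δ_{αγ}δ_{βδ} − δ_{αδ}δ_{βγ})·Γ̄̄
  − c·(δ_{αγ}Γ̄_{βδ} − δ_{βγ}Γ̄_{αδ} − δ_{αδ}Γ̄_{βγ} + δ_{βδ}Γ̄_{αγ})`. -/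
def Qgen {ι : Type*} [Fintype ι] [DecidableEq ι] (a b c : ℝ)
    (Γ : Matrix (ι × ι) (ι × ι) ℝ) : Matrix (ι × ι) (ι × ι) ℝ :=
  fun p q =>
    a * Γ p q
    + b * ((if p.1 = q.1 then (1 : ℝ) else 0) * (if p.2 = q.2 then (1 : ℝ) else 0)
        - (if p.1 = q.2 then (1 : ℝ) else 0) * (if p.2 = q.1 then (1 : ℝ) else 0)) * dTr Γ
    - c * ((if p.1 = q.1 then (1 : ℝ) else 0) * pTr Γ p.2 q.2
        - (if p.2 = q.1 then (1 : ℝ) else 0) * pTr Γ p.1 q.2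
        - (if p.1 = q.2 then (1 : ℝ) else 0) * pTr Γ p.2 q.1
        + (if p.2 = q.2 then (1 : ℝ) else 0) * pTr Γ p.1 q.1)

/-- The partial trace of a generalized `Q` map. -/
theorem pTr_Qgen {ι : Type*} [Fintype ι] [DecidableEq ι] (a b c : ℝ)
    (Γ : Matrix (ι × ι) (ι × ι) ℝ) (α γ : ι) :
    pTr (Qgen a b c Γ) α γ =
      (a - c * ((Fintype.card ι : ℝ) - 2)) * pTr Γ α γ
        + (b * ((Fintype.card ι : ℝ) - 1) - c) * (if α = γ then (1 : ℝ) else 0) * dTr Γ := by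
  have h₁ : ∑ l : ι, Γ (α, l) (γ, l) = pTr Γ α γ := rfl
  have h₂ : ∑ l : ι, (if α = γ then (1 : ℝ) else 0) * pTr Γ l l
      = (if α = γ then (1 : ℝ) else 0) * dTr Γ := (Finset.mul_sum ..).symm
  have h₃ : ∑ l : ι, (if α = l then (1 : ℝ) else 0) * (if l = γ then (1 : ℝ) else 0)
      = if α = γ then (1 : ℝ) else 0 := by simp
  have h₄ : ∑ l : ι, (if l = γ then (1 : ℝ) else 0) * pTr Γ α l = pTr Γ α γ := by simp
  have h₅ : ∑ l : ι, (if α = l then (1 : ℝ) else 0) * pTr Γ l γ = pTr Γ α γ := by simp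
  have h₆ : ∑ _l : ι, (if α = γ then (1 : ℝ) else 0)
      = (Fintype.card ι : ℝ) * (if α = γ then (1 : ℝ) else 0) := by
    rw [Finset.sum_const, Finset.card_univ, nsmul_eq_mul]
  rw [pTr]
  simp only [Qgen, if_true, mul_one, one_mul, Finset.sum_add_distrib, Finset.sum_sub_distrib,
    ← Finset.mul_sum, ← Finset.sum_mul, h₁, h₂, h₃, h₄, h₅, h₆, Finset.sum_const,
    Finset.card_univ, nsmul_eq_mul]
  ring

/-- The double trace of a generalized `Q` map. -/
theorem dTr_Qgen {ι : Type*} [Fintype ι] [DecidableEq ι] (a b c : ℝ)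
    (Γ : Matrix (ι × ι) (ι × ι) ℝ) :
    dTr (Qgen a b c Γ) =
      (a - 2 * c * ((Fintype.card ι : ℝ) - 1)
        + b * (Fintype.card ι : ℝ) * ((Fintype.card ι : ℝ) - 1)) * dTr Γ := by
  have h : ∑ l : ι, pTr Γ l l = dTr Γ := rfl
  rw [dTr]
  simp only [pTr_Qgen, if_true, mul_one, Finset.sum_add_distrib, ← Finset.mul_sum, h,
    Finset.sum_const, Finset.card_univ, nsmul_eq_mul]
  ring

/-- Generalized `Q` maps are closed under composition. -/
theorem Qgen_Qgen {ι : Type*} [Fintype ι] [DecidableEq ι] (a b c a' b' c' : ℝ)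
    (Γ : Matrix (ι × ι) (ι × ι) ℝ) :
    Qgen a' b' c' (Qgen a b c Γ) =
      Qgen (a' * a)
        (a' * b + b' * (a - 2 * c * ((Fintype.card ι : ℝ) - 1)
            + b * (Fintype.card ι : ℝ) * ((Fintype.card ι : ℝ) - 1))
          - 2 * c' * (b * ((Fintype.card ι : ℝ) - 1) - c))
        (a' * c + c' * (a - c * ((Fintype.card ι : ℝ) - 2))) Γ := by
  ext p q
  rw [Qgen, pTr_Qgen, pTr_Qgen, pTr_Qgen, pTr_Qgen, dTr_Qgen, Qgen, Qgen]
  ring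

/-- The square of the homogeneous `Q` condition map `Q(1, 1/(N(N−1)), 1/(N−1))`
is the generalized `Q` map with coefficients `a = 1`,
`b = (4N² + 2N − 4NM + M² − M)/(N²(N−1)²)` and `c = (2N − M)/(N−1)²`. -/
theorem Qcondition_squared_eq_Qgen
    {ι : Type*} [Fintype ι] [DecidableEq ι] (N : ℕ) (hN : 2 ≤ N)
    (M : ℝ) (hM : M = (Fintype.card ι : ℝ))
    (Γ : Matrix (ι × ι) (ι × ι) ℝ) :
    Qgen 1 (1 / ((N : ℝ) * ((N : ℝ) - 1))) (1 / ((N : ℝ) - 1))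
        (Qgen 1 (1 / ((N : ℝ) * ((N : ℝ) - 1))) (1 / ((N : ℝ) - 1)) Γ) =
      Qgen 1
        ((4 * (N : ℝ) ^ 2 + 2 * (N : ℝ) - 4 * (N : ℝ) * M + M ^ 2 - M) /
          ((N : ℝ) ^ 2 * ((N : ℝ) - 1) ^ 2))
        ((2 * (N : ℝ) - M) / (((N : ℝ) - 1) ^ 2))
        Γ := by
  have hN₀ : (N : ℝ) ≠ 0 := by
    exact_mod_cast (by omega : N ≠ 0)
  have hN₁ : (N : ℝ) - 1 ≠ 0 :=
    sub_ne_zero.mpr (by exact_mod_cast (by omega : N ≠ 1))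
  rw [Qgen_Qgen, ← hM]
  congr 1
  · norm_num
  · field_simp
    ring
  · field_simp
    ring
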